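/- For every even integer k ≥ 10, the graph H_k is bipartite, i.e., 2-colorable. -/

import Mathlib

open SimpleGraph

/-- Vertex type of the graph `H_k`: four disjoint families
`b_i` (`i` mod `k`), `u_j` (`j` mod `3k`), `v_j` (`j` mod `3k`), `a_i` (`i` mod `k`). -/
inductive HkV (k : ℕ) : Type where
  | b : ZMod k → HkV k
  | u : ZMod (3 * k) → HkV k
  | v : ZMod (3 * k) → HkV k
  | a : ZMod k → HkV k
deriving DecidableEq

/-- The natural map sending the residue `i` mod `k` to the residue `3 i` mod `3 k`. -/
def HkV.tr (k : ℕ) (i : ZMod k) : ZMod (3 * k) := 3 * (i.val : ZMod (3 * k))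

/-- The base edge relation of `H_k`: the four cycles
`b_1 ⋯ b_k`, `u_1 ⋯ u_{3k}`, `v_1 ⋯ v_{3k}`, `a_1 ⋯ a_k`, together with the edges
`b_i u_{3i-2}`, `b_i u_{3i}`, `b_i u_{3i+2}`, the edges `u_j v_{j-1}`, `u_j v_{j+1}`,
and the edges `a_i v_{3i-2}`, `a_i v_{3i}`, `a_i v_{3i+2}` (indices modulo `k`
resp. `3k`). -/
def hkRel (k : ℕ) : HkV k → HkV k → Prop
  | .b i, .b i' => i' = i + 1
  | .u j, .u j' => j' = j + 1
  | .v j, .v j' => j' = j + 1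
  | .a i, .a i' => i' = i + 1
  | .b i, .u j => j = HkV.tr k i - 2 ∨ j = HkV.tr k i ∨ j = HkV.tr k i + 2
  | .u j, .v j' => j' = j - 1 ∨ j' = j + 1
  | .a i, .v j => j = HkV.tr k i - 2 ∨ j = HkV.tr k i ∨ j = HkV.tr k i + 2
  | _, _ => False

/-- The graph `H_k` from the paper. -/
def Hk (k : ℕ) : SimpleGraph (HkV k) := SimpleGraph.fromRel (hkRel k)

/-- The reduction modulo `2` of the residue `3 i` agrees with that of `i`. -/
theorem HkV.castHom_tr {k : ℕ} [NeZero k] (h : 2 ∣ k) (h3 : 2 ∣ 3 * k) (i : ZMod k) :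
    ZMod.castHom h3 (ZMod 2) (HkV.tr k i) = ZMod.castHom h (ZMod 2) i := by
  conv_rhs => rw [← ZMod.natCast_zmod_val i]
  simp only [HkV.tr, map_mul, map_ofNat, map_natCast]
  rw [show (3 : ZMod 2) = 1 from rfl, one_mul]

/-- The colouring of `H_k` by the parity of the index, shifted by one on the two `k`-cycles. -/
def HkV.parity {k : ℕ} (h : 2 ∣ k) (h3 : 2 ∣ 3 * k) : HkV k → ZMod 2
  | .b i => ZMod.castHom h (ZMod 2) i + 1
  | .u j => ZMod.castHom h3 (ZMod 2) j
  | .v j => ZMod.castHom h3 (ZMod 2) j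
  | .a i => ZMod.castHom h (ZMod 2) i + 1

theorem HkV.parity_ne_of_hkRel {k : ℕ} [NeZero k] (h : 2 ∣ k) (h3 : 2 ∣ 3 * k) {x y : HkV k}
    (hxy : hkRel k x y) : HkV.parity h h3 x ≠ HkV.parity h h3 y := by
  have add_one_ne : ∀ z : ZMod 2, z + 1 ≠ z := by decide
  have ne_add_one : ∀ z : ZMod 2, z ≠ z + 1 := by decide
  have ne_sub_one : ∀ z : ZMod 2, z ≠ z - 1 := by decide
  have two_eq_zero : (2 : ZMod 2) = 0 := rfl
  cases x <;> cases y <;> simp only [hkRel] at hxy <;>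
    first
    | (subst hxy
       simpa only [HkV.parity, map_add, map_one] using ne_add_one _)
    | (rcases hxy with rfl | rfl | rfl <;>
        simpa only [HkV.parity, map_add, map_sub, map_ofNat, HkV.castHom_tr h h3, two_eq_zero,
          add_zero, sub_zero] using add_one_ne _)
    | (rcases hxy with rfl | rfl
       · simpa only [HkV.parity, map_sub, map_one] using ne_sub_one _
       · simpa only [HkV.parity, map_add, map_one] using ne_add_one _)

/-- for every even integer `k ≥ 10`, the graph `H_k` is bipartite,
i.e. 2-colorable. -/
theorem Hk_bipartite (k : ℕ) (hk : 10 ≤ k) (hke : Even k) :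
    (Hk k).Colorable 2 := by
  have : NeZero k := ⟨by omega⟩
  have h : 2 ∣ k := hke.two_dvd
  have h3 : 2 ∣ 3 * k := h.mul_left 3
  have c : (Hk k).Coloring (ZMod 2) := Coloring.mk (HkV.parity h h3) fun {x y} hxy => by
    obtain ⟨-, hxy | hxy⟩ := (SimpleGraph.fromRel_adj _ _ _).1 hxy
    · exact HkV.parity_ne_of_hkRel h h3 hxy
    · exact (HkV.parity_ne_of_hkRel h h3 hxy).symm
  exact c.colorable
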